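/- Fix an integer d ≥ 3 and let L_d = {0, 1/(d−1), …, 1}. There is no function G : L_d^3 → L_d^3 which simultaneously: (a) is a bijection of L_d^3 (reversible); (b) is weakly conservative, i.e., the sum of the three output values equals the sum of the three input values for every input; (c) agrees with the Boolean Fredkin gate on all triples from {0,1}^3 (i.e., G(x₁,x₂,x₃) = (x₁, (x₁∧x₂)∨(¬x₁∧x₃), (¬x₁∧x₂)∨(x₁∧x₃)) whenever x₁,x₂,x₃ ∈ {0,1}); and (d) realizes each of the six binary connectives min(x,y), max(x,y), x →_L y = min(1,1−x+y), x →_G y (equal to y if y < x and 1 otherwise), x ⊕ y = min(1, x+y), and x ⊙ y = max(0, x+y−1), where G realizes a binary connective ∘ when there exist two distinct input positions p, q, a constant c ∈ L_d placed at the remaining input position, and an output position k, such that for all a, b ∈ L_d the k-th output component of G applied to the triple with a at position p, b at position q and c at the remaining position equals a ∘ b. -/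

import Mathlib

/-- The set of truth values `L_d = {0, 1/(d-1), …, 1}` as a finite set of reals. -/
noncomputable def Ld (d : ℕ) : Finset ℝ :=
  (Finset.range d).image (fun k : ℕ => (k : ℝ) / ((d : ℝ) - 1))

/-- A `(3,d)`-gate `G` realizes the binary connective `op` when there are two distinct
input positions `p, q`, a constant `c ∈ L_d` at the remaining input position, and an
output position `k` such that feeding `a` at `p` and `b` at `q` makes the `k`-th output
equal `op a b`, for all truth values `a, b ∈ L_d`. -/
def Realizes (d : ℕ) (G : (Fin 3 → ℝ) → (Fin 3 → ℝ)) (op : ℝ → ℝ → ℝ) : Prop :=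
  ∃ (p q k : Fin 3) (c : ℝ), p ≠ q ∧ c ∈ Ld d ∧
    ∀ a ∈ Ld d, ∀ b ∈ Ld d,
      G (fun t => if t = p then a else if t = q then b else c) k = op a b

theorem mem_Ld_iff {d : ℕ} {x : ℝ} :
    x ∈ Ld d ↔ ∃ k : ℕ, k < d ∧ (k : ℝ) / ((d : ℝ) - 1) = x := by
  simp [Ld]

theorem nonneg_of_mem_Ld {d : ℕ} (hd : 2 ≤ d) {x : ℝ} (hx : x ∈ Ld d) : 0 ≤ x := by
  obtain ⟨k, -, rfl⟩ := mem_Ld_iff.1 hx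
  have : (2 : ℝ) ≤ d := by exact_mod_cast hd
  exact div_nonneg (Nat.cast_nonneg k) (by linarith)

theorem le_one_of_mem_Ld {d : ℕ} (hd : 2 ≤ d) {x : ℝ} (hx : x ∈ Ld d) : x ≤ 1 := by
  obtain ⟨k, hk, rfl⟩ := mem_Ld_iff.1 hx
  have h2 : (2 : ℝ) ≤ d := by exact_mod_cast hd
  have hk' : (k : ℝ) + 1 ≤ d := by exact_mod_cast hk
  rw [div_le_one (by linarith)]
  linarith

theorem one_sub_mem_Ld {d : ℕ} (hd : 2 ≤ d) {x : ℝ} (hx : x ∈ Ld d) : 1 - x ∈ Ld d := by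
  obtain ⟨k, hk, rfl⟩ := mem_Ld_iff.1 hx
  have h2 : (2 : ℝ) ≤ d := by exact_mod_cast hd
  have h0 : (d : ℝ) - 1 ≠ 0 := by linarith
  refine mem_Ld_iff.2 ⟨d - 1 - k, by omega, ?_⟩
  rw [Nat.cast_sub (by omega), Nat.cast_sub (by omega)]
  field_simp
  simp

theorem zero_mem_Ld {d : ℕ} (hd : 2 ≤ d) : (0 : ℝ) ∈ Ld d :=
  mem_Ld_iff.2 ⟨0, by omega, by simp⟩

theorem one_mem_Ld {d : ℕ} (hd : 2 ≤ d) : (1 : ℝ) ∈ Ld d := by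
  simpa using one_sub_mem_Ld hd (zero_mem_Ld hd)

/-- For `d ≥ 3`, the least positive truth value is at most `1 / 2`. -/
theorem exists_mem_Ld_pos_le_half {d : ℕ} (hd : 3 ≤ d) : ∃ h ∈ Ld d, 0 < h ∧ h ≤ 1 / 2 := by
  have h3 : (3 : ℝ) ≤ d := by exact_mod_cast hd
  refine ⟨1 / ((d : ℝ) - 1), mem_Ld_iff.2 ⟨1, by omega, by simp⟩, ?_, ?_⟩
  · exact one_div_pos.2 (by linarith)
  · exact one_div_le_one_div_of_le (by norm_num) (by linarith)

/-- The input triple with `a` at position `p`, `b` at position `q` and `c` elsewhere. -/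
def placeInputs (p q : Fin 3) (a b c : ℝ) : Fin 3 → ℝ :=
  fun t => if t = p then a else if t = q then b else c

theorem placeInputs_mem {s : Set ℝ} {p q : Fin 3} {a b c : ℝ} (ha : a ∈ s) (hb : b ∈ s)
    (hc : c ∈ s) (i : Fin 3) : placeInputs p q a b c i ∈ s := by
  unfold placeInputs
  split_ifs <;> assumption

theorem placeInputs_sum {p q : Fin 3} (hpq : p ≠ q) (a b c : ℝ) :
    ∑ i, placeInputs p q a b c i = a + b + c := by
  fin_cases p <;> fin_cases q <;> simp_all [placeInputs, Fin.sum_univ_three] <;> ring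

/-- Agreement with the Boolean Fredkin gate on `{0,1}³`. -/
def ExtendsFredkin (G : (Fin 3 → ℝ) → (Fin 3 → ℝ)) : Prop :=
  ∀ x : Fin 3 → ℝ, (∀ i, x i = 0 ∨ x i = 1) →
    G x 0 = x 0 ∧
    G x 1 = max (min (x 0) (x 1)) (min (1 - x 0) (x 2)) ∧
    G x 2 = max (min (1 - x 0) (x 1)) (min (x 0) (x 2))

section Fredkin

variable {G : (Fin 3 → ℝ) → (Fin 3 → ℝ)} {p q k : Fin 3}

/-- With constant `1`, a Fredkin gate computes Boolean implication only from the control line. -/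
theorem ExtendsFredkin.positions_of_imp (hF : ExtendsFredkin G) (hpq : p ≠ q)
    (h00 : G (placeInputs p q 0 0 1) k = 1) (h01 : G (placeInputs p q 0 1 1) k = 1)
    (h10 : G (placeInputs p q 1 0 1) k = 0) :
    p = 0 ∧ (q = 1 ∧ k = 1 ∨ q = 2 ∧ k = 2) := by
  have e00 := hF (placeInputs p q 0 0 1) (placeInputs_mem (s := {x | x = 0 ∨ x = 1})
    (by simp) (by simp) (by simp))
  have e01 := hF (placeInputs p q 0 1 1) (placeInputs_mem (s := {x | x = 0 ∨ x = 1})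
    (by simp) (by simp) (by simp))
  have e10 := hF (placeInputs p q 1 0 1) (placeInputs_mem (s := {x | x = 0 ∨ x = 1})
    (by simp) (by simp) (by simp))
  generalize G (placeInputs p q 0 0 1) = u at *
  generalize G (placeInputs p q 0 1 1) = v at *
  generalize G (placeInputs p q 1 0 1) = w at *
  fin_cases p <;> fin_cases q <;> fin_cases k <;> simp_all [placeInputs]

/-- With constant `1`, a Fredkin gate computes Boolean disjunction only from the control line
and one target line. -/
theorem ExtendsFredkin.positions_of_or (hF : ExtendsFredkin G) (hpq : p ≠ q)
    (h00 : G (placeInputs p q 0 0 1) k = 0) (h01 : G (placeInputs p q 0 1 1) k = 1)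
    (h10 : G (placeInputs p q 1 0 1) k = 1) :
    (p = 0 ∧ q = 1 ∨ p = 1 ∧ q = 0) ∧ k = 2 ∨ (p = 0 ∧ q = 2 ∨ p = 2 ∧ q = 0) ∧ k = 1 := by
  have e00 := hF (placeInputs p q 0 0 1) (placeInputs_mem (s := {x | x = 0 ∨ x = 1})
    (by simp) (by simp) (by simp))
  have e01 := hF (placeInputs p q 0 1 1) (placeInputs_mem (s := {x | x = 0 ∨ x = 1})
    (by simp) (by simp) (by simp))
  have e10 := hF (placeInputs p q 1 0 1) (placeInputs_mem (s := {x | x = 0 ∨ x = 1})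
    (by simp) (by simp) (by simp))
  generalize G (placeInputs p q 0 0 1) = u at *
  generalize G (placeInputs p q 0 1 1) = v at *
  generalize G (placeInputs p q 1 0 1) = w at *
  fin_cases p <;> fin_cases q <;> fin_cases k <;> simp_all [placeInputs]

end Fredkin

section Conservative

variable {d : ℕ} {G : (Fin 3 → ℝ) → (Fin 3 → ℝ)}

/-- A connective with value `1` at `(0, 0)` and Boolean restriction an implication is realized
by a conservative extension of the Fredkin gate only with constant `1` on a target line. -/
theorem Realizes.imp_cases (hd : 2 ≤ d)
    (hM : ∀ x : Fin 3 → ℝ, (∀ i, x i ∈ Ld d) → ∀ i, G x i ∈ Ld d)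
    (hS : ∀ x : Fin 3 → ℝ, (∀ i, x i ∈ Ld d) → ∑ i, G x i = ∑ i, x i)
    (hF : ExtendsFredkin G) {op : ℝ → ℝ → ℝ} (h : Realizes d G op)
    (h00 : op 0 0 = 1) (h01 : op 0 1 = 1) (h10 : op 1 0 = 0) :
    (∀ a ∈ Ld d, ∀ b ∈ Ld d, G (placeInputs 0 1 a b 1) 1 = op a b) ∨
      (∀ a ∈ Ld d, ∀ b ∈ Ld d, G (placeInputs 0 2 a b 1) 2 = op a b) := by
  obtain ⟨p, q, k, c, hpq, hc, h⟩ := h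
  change ∀ a ∈ Ld d, ∀ b ∈ Ld d, G (placeInputs p q a b c) k = op a b at h
  have z := zero_mem_Ld hd
  have o := one_mem_Ld hd
  obtain rfl : c = 1 := by
    refine le_antisymm (le_one_of_mem_Ld hd hc) ?_
    have hx := placeInputs_mem (s := (Ld d : Set ℝ)) (p := p) (q := q) z z hc
    have hs := hS _ hx
    rw [placeInputs_sum hpq] at hs
    have hle := Finset.single_le_sum (f := G (placeInputs p q 0 0 c))
      (fun i _ => nonneg_of_mem_Ld hd (hM _ hx i)) (Finset.mem_univ k)
    rw [h 0 z 0 z, h00] at hle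
    linarith
  obtain ⟨rfl, ⟨rfl, rfl⟩ | ⟨rfl, rfl⟩⟩ := hF.positions_of_imp hpq
    ((h 0 z 0 z).trans h00) ((h 0 z 1 o).trans h01) ((h 1 o 0 z).trans h10)
  · exact Or.inl h
  · exact Or.inr h

theorem placeInputs_comm {p q : Fin 3} (hpq : p ≠ q) (a b c : ℝ) :
    placeInputs p q a b c = placeInputs q p b a c := by
  funext t
  unfold placeInputs
  split_ifs <;> simp_all

/-- An injective conservative gate realizes truncated addition only with constant `1`: the `d`
inputs with `a + b = 1` need `d` distinct ways of splitting the constant. -/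
theorem const_eq_one_of_truncatedAdd (hd : 2 ≤ d)
    (hM : ∀ x : Fin 3 → ℝ, (∀ i, x i ∈ Ld d) → ∀ i, G x i ∈ Ld d)
    (hI : Set.InjOn G {x : Fin 3 → ℝ | ∀ i, x i ∈ Ld d})
    (hS : ∀ x : Fin 3 → ℝ, (∀ i, x i ∈ Ld d) → ∑ i, G x i = ∑ i, x i)
    {p q k : Fin 3} {c : ℝ} (hpq : p ≠ q) (hc : c ∈ Ld d)
    (h : ∀ a ∈ Ld d, ∀ b ∈ Ld d, G (placeInputs p q a b c) k = min 1 (a + b)) : c = 1 := by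
  have hx : ∀ a ∈ Ld d, ∀ i, placeInputs p q a (1 - a) c i ∈ Ld d := fun a ha =>
    placeInputs_mem (s := (Ld d : Set ℝ)) ha (one_sub_mem_Ld hd ha) hc
  have hk : ∀ a ∈ Ld d, G (placeInputs p q a (1 - a) c) k = 1 := fun a ha => by
    rw [h a ha _ (one_sub_mem_Ld hd ha)]
    simp
  obtain ⟨l, m, hsum, hext⟩ : ∃ l m : Fin 3, (∀ f : Fin 3 → ℝ, ∑ i, f i = f k + f l + f m) ∧
      ∀ i, i = k ∨ i = l ∨ i = m := by
    refine ⟨k + 1, k + 2, fun f => ?_, by clear h hk; revert k; decide⟩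
    fin_cases k <;> simp [Fin.sum_univ_three] <;> ring
  have hlm : ∀ a ∈ Ld d, G (placeInputs p q a (1 - a) c) l +
      G (placeInputs p q a (1 - a) c) m = c := fun a ha => by
    have hs := hS _ (hx a ha)
    rw [placeInputs_sum hpq, hsum, hk a ha] at hs
    linarith
  have hsurj : Set.SurjOn (fun a => G (placeInputs p q a (1 - a) c) l) (Ld d) (Ld d) := by
    refine Finset.surjOn_of_injOn_of_card_le _ (fun a ha => hM _ (hx a ha) l) ?_ le_rfl
    intro a ha b hb hab
    have hGab : G (placeInputs p q a (1 - a) c) = G (placeInputs p q b (1 - b) c) := by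
      have h1 := hlm a ha
      have h2 := hlm b hb
      have h3 := (hk a ha).trans (hk b hb).symm
      funext i
      rcases hext i with rfl | rfl | rfl
      · exact h3
      · exact hab
      · simp only at hab
        linarith
    simpa [placeInputs] using congrFun (hI (hx a ha) (hx b hb) hGab) p
  obtain ⟨a, ha, ha1⟩ := hsurj (one_mem_Ld hd)
  have hs := hlm a ha
  have hm := nonneg_of_mem_Ld hd (hM _ (hx a ha) m)
  simp only at ha1
  linarith [le_one_of_mem_Ld hd hc]

theorem Realizes.truncatedAdd_cases (hd : 2 ≤ d)
    (hM : ∀ x : Fin 3 → ℝ, (∀ i, x i ∈ Ld d) → ∀ i, G x i ∈ Ld d)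
    (hI : Set.InjOn G {x : Fin 3 → ℝ | ∀ i, x i ∈ Ld d})
    (hS : ∀ x : Fin 3 → ℝ, (∀ i, x i ∈ Ld d) → ∑ i, G x i = ∑ i, x i)
    (hF : ExtendsFredkin G) (h : Realizes d G (fun a b => min 1 (a + b))) :
    (∀ a ∈ Ld d, ∀ b ∈ Ld d, G (placeInputs 0 1 a b 1) 2 = min 1 (a + b)) ∨
      (∀ a ∈ Ld d, ∀ b ∈ Ld d, G (placeInputs 0 2 a b 1) 1 = min 1 (a + b)) := by
  obtain ⟨p, q, k, c, hpq, hc, h⟩ := h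
  change ∀ a ∈ Ld d, ∀ b ∈ Ld d, G (placeInputs p q a b c) k = min 1 (a + b) at h
  obtain rfl := const_eq_one_of_truncatedAdd hd hM hI hS hpq hc h
  have z := zero_mem_Ld hd
  have o := one_mem_Ld hd
  have hswap : ∀ a ∈ Ld d, ∀ b ∈ Ld d, G (placeInputs q p a b 1) k = min 1 (a + b) :=
    fun a ha b hb => by rw [placeInputs_comm hpq.symm, h b hb a ha, add_comm]
  obtain ⟨⟨rfl, rfl⟩ | ⟨rfl, rfl⟩, rfl⟩ | ⟨⟨rfl, rfl⟩ | ⟨rfl, rfl⟩, rfl⟩ :=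
    hF.positions_of_or hpq ((h 0 z 0 z).trans (by simp)) ((h 0 z 1 o).trans (by simp))
      ((h 1 o 0 z).trans (by simp))
  · exact Or.inl h
  · exact Or.inl hswap
  · exact Or.inr h
  · exact Or.inr hswap

/-- Truncated addition and an implication cannot share the same input lines. -/
theorem false_of_imp_of_truncatedAdd (hd : 3 ≤ d)
    (hI : Set.InjOn G {x : Fin 3 → ℝ | ∀ i, x i ∈ Ld d})
    (hS : ∀ x : Fin 3 → ℝ, (∀ i, x i ∈ Ld d) → ∑ i, G x i = ∑ i, x i)
    {op : ℝ → ℝ → ℝ} (hop : ∀ a b, a ≤ b → b ≤ 1 → op a b = 1)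
    {q k l : Fin 3} (hq : 0 ≠ q)
    (hsum : ∀ f : Fin 3 → ℝ, ∑ i, f i = f 0 + f k + f l)
    (hext : ∀ i, i = 0 ∨ i = k ∨ i = l)
    (himp : ∀ a ∈ Ld d, ∀ b ∈ Ld d, G (placeInputs 0 q a b 1) k = op a b)
    (hadd : ∀ a ∈ Ld d, ∀ b ∈ Ld d, G (placeInputs 0 q a b 1) l = min 1 (a + b)) : False := by
  have hd2 : 2 ≤ d := by omega
  obtain ⟨h, hh, hpos, hhalf⟩ := exists_mem_Ld_pos_le_half hd
  have hx : ∀ a ∈ Ld d, ∀ i, placeInputs 0 q a (1 - a) 1 i ∈ Ld d := fun a ha =>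
    placeInputs_mem (s := (Ld d : Set ℝ)) ha (one_sub_mem_Ld hd2 ha) (one_mem_Ld hd2)
  have key : ∀ a ∈ Ld d, a ≤ 1 / 2 → G (placeInputs 0 q a (1 - a) 1) =
      fun i => if i = 0 then 0 else 1 := by
    intro a ha hle
    have ha0 := nonneg_of_mem_Ld hd2 ha
    have hk : G (placeInputs 0 q a (1 - a) 1) k = 1 := by
      rw [himp a ha _ (one_sub_mem_Ld hd2 ha), hop _ _ (by linarith) (by linarith)]
    have hl : G (placeInputs 0 q a (1 - a) 1) l = 1 := by
      rw [hadd a ha _ (one_sub_mem_Ld hd2 ha)]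
      simp
    have h0 : G (placeInputs 0 q a (1 - a) 1) 0 = 0 := by
      have hs := hS _ (hx a ha)
      rw [placeInputs_sum hq, hsum, hk, hl] at hs
      linarith
    funext i
    split_ifs with hi
    · rw [hi, h0]
    · rcases hext i with rfl | rfl | rfl
      · exact absurd rfl hi
      · exact hk
      · exact hl
  have z := zero_mem_Ld hd2
  have heq := hI (hx 0 z) (hx h hh) ((key 0 z (by norm_num)).trans (key h hh hhalf).symm)
  have := congrFun heq 0
  simp [placeInputs] at this
  linarith

end Conservative

theorem stmt_10 (d : ℕ) (hd : 3 ≤ d) :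
    ¬ ∃ G : (Fin 3 → ℝ) → (Fin 3 → ℝ),
      -- (a) reversibility: G is a bijection of L_d³
      Set.BijOn G {x : Fin 3 → ℝ | ∀ i, x i ∈ Ld d} {x : Fin 3 → ℝ | ∀ i, x i ∈ Ld d} ∧
      -- (b) weak conservativeness
      (∀ x : Fin 3 → ℝ, (∀ i, x i ∈ Ld d) →
        G x 0 + G x 1 + G x 2 = x 0 + x 1 + x 2) ∧
      -- (c) G agrees with the Boolean Fredkin gate on {0,1}³
      (∀ x : Fin 3 → ℝ, (∀ i, x i = 0 ∨ x i = 1) →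
        G x 0 = x 0 ∧
        G x 1 = max (min (x 0) (x 1)) (min (1 - x 0) (x 2)) ∧
        G x 2 = max (min (1 - x 0) (x 1)) (min (x 0) (x 2))) ∧
      -- (d) G realizes the six binary connectives
      Realizes d G (fun a b => min a b) ∧
      Realizes d G (fun a b => max a b) ∧
      Realizes d G (fun a b => min 1 (1 - a + b)) ∧
      Realizes d G (fun a b => if b < a then b else 1) ∧
      Realizes d G (fun a b => min 1 (a + b)) ∧
      Realizes d G (fun a b => max 0 (a + b - 1)) := by
  rintro ⟨G, hbij, hcons, hF, -, -, hL, hG, hadd, -⟩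
  have hd2 : 2 ≤ d := by omega
  have hM : ∀ x : Fin 3 → ℝ, (∀ i, x i ∈ Ld d) → ∀ i, G x i ∈ Ld d :=
    fun x hx => hbij.mapsTo hx
  have hS : ∀ x : Fin 3 → ℝ, (∀ i, x i ∈ Ld d) → ∑ i, G x i = ∑ i, x i := fun x hx => by
    simpa only [Fin.sum_univ_three] using hcons x hx
  have hLop : ∀ a b : ℝ, a ≤ b → b ≤ 1 → min 1 (1 - a + b) = 1 :=
    fun a b hab _ => min_eq_left (by linarith)
  have hGop : ∀ a b : ℝ, a ≤ b → b ≤ 1 → (if b < a then b else 1) = 1 :=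
    fun a b hab _ => if_neg (not_lt.2 hab)
  obtain ⟨h, hh, hpos, hhalf⟩ := exists_mem_Ld_pos_le_half hd
  have z := zero_mem_Ld hd2
  have hne : min 1 (1 - h + 0) ≠ if (0 : ℝ) < h then 0 else 1 := by
    rw [if_pos hpos, min_eq_right (by linarith)]
    linarith
  have no1 : ∀ {op : ℝ → ℝ → ℝ}, (∀ a b, a ≤ b → b ≤ 1 → op a b = 1) →
      (∀ a ∈ Ld d, ∀ b ∈ Ld d, G (placeInputs 0 1 a b 1) 1 = op a b) →
      (∀ a ∈ Ld d, ∀ b ∈ Ld d, G (placeInputs 0 1 a b 1) 2 = min 1 (a + b)) → False :=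
    fun hop => false_of_imp_of_truncatedAdd hd hbij.injOn hS hop (by decide)
      Fin.sum_univ_three (by decide)
  have no2 : ∀ {op : ℝ → ℝ → ℝ}, (∀ a b, a ≤ b → b ≤ 1 → op a b = 1) →
      (∀ a ∈ Ld d, ∀ b ∈ Ld d, G (placeInputs 0 2 a b 1) 2 = op a b) →
      (∀ a ∈ Ld d, ∀ b ∈ Ld d, G (placeInputs 0 2 a b 1) 1 = min 1 (a + b)) → False :=
    fun hop => false_of_imp_of_truncatedAdd hd hbij.injOn hS hop (by decide)
      (fun f => by rw [Fin.sum_univ_three]; ring) (by decide)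
  rcases hL.imp_cases hd2 hM hS hF (by norm_num) (by norm_num) (by norm_num) with hL | hL <;>
  rcases hG.imp_cases hd2 hM hS hF (by norm_num) (by norm_num) (by norm_num) with hG | hG <;>
  rcases hadd.truncatedAdd_cases hd2 hM hbij.injOn hS hF with hadd | hadd
  · exact no1 hLop hL hadd
  · exact hne ((hL h hh 0 z).symm.trans (hG h hh 0 z))
  · exact no1 hLop hL hadd
  · exact no2 hGop hG hadd
  · exact no1 hGop hG hadd
  · exact no2 hLop hL hadd
  · exact hne ((hL h hh 0 z).symm.trans (hG h hh 0 z))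
  · exact no2 hLop hL hadd
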